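/- arXiv:1803.07128 — 2 statements merged into one kernel-verified Lean document; each statement's English description precedes it below -/
import Mathlib

section
/- For all real numbers c, φ, φ', the ℓ² inner product of the squeezed-vacuum coefficient sequences ψ_{c,φ} and ψ_{c,φ'} (conjugate-linear in the first factor) satisfies Σ_{n=0}^∞ conj(ψ_{c,φ}(n)) · ψ_{c,φ'}(n) = (1/cosh c) · Σ_{k=0}^∞ C(2k, k) · (e^{i(φ' − φ)} · tanh²(c) / 4)^k = (1/cosh c) · (1 − e^{i(φ' − φ)} · tanh²(c))^(−1/2), where the last expression uses the principal branch of the complex power; in particular the series converges. This is the closed-form squeezing kernel ⟨(c, φ)|(c, φ')⟩ = √( sech(c)·sech(c) / (1 − e^{i(φ' − φ)} tanh(c) tanh(c)) ). -/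
/-- The squeezed-vacuum coefficient sequence: `ψ c φ (2k) =
(cosh c)^(-1/2) · (√((2k)!)/(2^k k!)) · (-e^{iφ} tanh c)^k`, and `ψ c φ n = 0` for odd `n`. -/
noncomputable def sqVac (c φ : ℝ) : ℕ → ℂ := fun n =>
  if Even n then
    ((Real.sqrt (Real.cosh c))⁻¹ : ℂ) *
      ((Real.sqrt (Nat.factorial n) / (2 ^ (n / 2) * Nat.factorial (n / 2)) : ℝ) : ℂ) *
      (-(Complex.exp (φ * Complex.I)) * (Real.tanh c : ℂ)) ^ (n / 2)
  else 0

theorem choose_neg_half (n : ℕ) :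
    Ring.choose (-(1 / 2 : ℂ)) n = (Nat.centralBinom n : ℂ) * (-1 / 4) ^ n := by
  rw [Ring.choose_eq_smul]
  induction n with
  | zero => simp
  | succ n ih =>
    have h := Nat.succ_mul_centralBinom_succ n
    have h' : ((n : ℂ) + 1) * (Nat.centralBinom (n + 1) : ℂ)
        = 2 * (2 * n + 1) * (Nat.centralBinom n : ℂ) := by exact_mod_cast h
    have hn : (n : ℂ) + 1 ≠ 0 := by exact_mod_cast Nat.succ_ne_zero n
    have hf : (Nat.factorial n : ℂ) ≠ 0 := by exact_mod_cast Nat.factorial_ne_zero n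
    have h2 : (Nat.centralBinom (n + 1) : ℂ)
        = 2 * (2 * n + 1) * (Nat.centralBinom n : ℂ) / (n + 1) := by
      rw [eq_div_iff hn, ← h']; ring
    have e : (descPochhammer ℤ (n + 1)).smeval (-(1 / 2 : ℂ))
        = (descPochhammer ℤ n).smeval (-(1 / 2 : ℂ)) * (-(1 / 2 : ℂ) - n) := by
      simp [descPochhammer_succ_right, Polynomial.smeval_mul, Polynomial.smeval_natCast]
    have ih' : (descPochhammer ℤ n).smeval (-(1 / 2 : ℂ))
        = (Nat.factorial n : ℂ) * ((Nat.centralBinom n : ℂ) * (-1 / 4) ^ n) := by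
      rw [← ih, smul_eq_mul, mul_inv_cancel_left₀ hf]
    rw [e, ih', h2, Nat.factorial_succ, smul_eq_mul]
    push_cast
    rw [pow_succ]
    field_simp
    ring

theorem hasSum_centralBinom (w : ℂ) (hw : ‖w‖ < 1) :
    HasSum (fun k : ℕ => (Nat.centralBinom k : ℂ) * (w / 4) ^ k) ((1 - w) ^ (-(1 / 2 : ℂ))) := by
  have h := (Complex.one_add_cpow_hasFPowerSeriesOnBall_zero (a := -(1 / 2 : ℂ))).hasSum
    (y := -w) (by
      rw [← ENNReal.ofReal_one, Metric.eball_ofReal]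
      simpa using hw)
  rw [zero_add, ← sub_eq_add_neg] at h
  convert! h using 2 with k
  rw [binomialSeries_apply, choose_neg_half]
  simp only [List.ofFn_const, List.prod_replicate, smul_eq_mul]
  rw [mul_assoc, ← mul_pow]
  congr 2
  ring

theorem sqVac_term (c φ φ' : ℝ) (k : ℕ) :
    (starRingEnd ℂ) (sqVac c φ (2 * k)) * sqVac c φ' (2 * k) =
      ((Real.cosh c : ℂ))⁻¹ * ((Nat.centralBinom k : ℂ) *
        (Complex.exp ((φ' - φ : ℝ) * Complex.I) * (Real.tanh c : ℂ) ^ 2 / 4) ^ k) := by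
  have hc : ((Real.sqrt (Real.cosh c) : ℂ))⁻¹ * ((Real.sqrt (Real.cosh c) : ℂ))⁻¹
      = ((Real.cosh c : ℂ))⁻¹ := by
    rw [← mul_inv, ← Complex.ofReal_mul, Real.mul_self_sqrt (Real.cosh_pos c).le]
  have hb : (Real.sqrt (Nat.factorial (2 * k)) / (2 ^ k * Nat.factorial k)) *
      (Real.sqrt (Nat.factorial (2 * k)) / (2 ^ k * Nat.factorial k))
      = (Nat.centralBinom k : ℝ) * (1 / 4) ^ k := by
    rw [div_mul_div_comm, Real.mul_self_sqrt (by positivity)]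
    have h : (Nat.centralBinom k : ℝ) * Nat.factorial k * Nat.factorial k
        = Nat.factorial (2 * k) := by
      have := Nat.choose_mul_factorial_mul_factorial (n := 2 * k) (k := k) (by omega)
      rw [show 2 * k - k = k by omega] at this
      exact_mod_cast this
    rw [← h]
    have hf : (Nat.factorial k : ℝ) ≠ 0 := by exact_mod_cast Nat.factorial_ne_zero k
    rw [show (4 : ℝ) = 2 * 2 by norm_num, one_div, inv_pow, mul_pow]
    field_simp
  have hb' := congrArg (fun x : ℝ => (x : ℂ)) hb
  simp only [Complex.ofReal_mul] at hb'
  have he : (starRingEnd ℂ) (-(Complex.exp (φ * Complex.I)) * (Real.tanh c : ℂ)) *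
      (-(Complex.exp (φ' * Complex.I)) * (Real.tanh c : ℂ)) =
      Complex.exp ((φ' - φ : ℝ) * Complex.I) * (Real.tanh c : ℂ) ^ 2 := by
    have : Complex.exp ((φ' - φ : ℝ) * Complex.I)
        = (starRingEnd ℂ) (Complex.exp (φ * Complex.I)) * Complex.exp (φ' * Complex.I) := by
      rw [← Complex.exp_conj, ← Complex.exp_add]
      congr 1
      simp only [map_mul, Complex.conj_ofReal, Complex.conj_I]
      push_cast
      ring
    rw [this, map_mul, map_neg, Complex.conj_ofReal]
    ring
  have hk : 2 * k / 2 = k := by omega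
  simp only [sqVac, even_two_mul, if_true, hk]
  rw [map_mul, map_mul, map_pow, map_inv₀, Complex.conj_ofReal, Complex.conj_ofReal]
  rw [mul_mul_mul_comm (_ * _) (_ ^ _), ← mul_pow, he, mul_mul_mul_comm, hc, hb',
    div_eq_mul_one_div _ (4 : ℂ), mul_pow _ (1 / 4 : ℂ)]
  push_cast
  ring

/-- The ℓ² inner product of two squeezed-vacuum coefficient sequences with the same
squeezing strength `c` equals `(1/cosh c) · ∑ C(2k,k) (e^{i(φ'-φ)} tanh²c / 4)^k
= (1/cosh c) · (1 - e^{i(φ'-φ)} tanh²c)^(-1/2)` (principal branch). -/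
theorem sqVac_inner_closed_form (c φ φ' : ℝ) :
    HasSum (fun n : ℕ => (starRingEnd ℂ) (sqVac c φ n) * sqVac c φ' n)
      (((Real.cosh c : ℂ))⁻¹ *
        (1 - Complex.exp ((φ' - φ : ℝ) * Complex.I) * (Real.tanh c : ℂ) ^ 2)
          ^ (-(1 / 2 : ℂ))) ∧
    HasSum (fun k : ℕ => ((Real.cosh c : ℂ))⁻¹ * (Nat.centralBinom k : ℂ) *
        (Complex.exp ((φ' - φ : ℝ) * Complex.I) * (Real.tanh c : ℂ) ^ 2 / 4) ^ k)
      (((Real.cosh c : ℂ))⁻¹ *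
        (1 - Complex.exp ((φ' - φ : ℝ) * Complex.I) * (Real.tanh c : ℂ) ^ 2)
          ^ (-(1 / 2 : ℂ))) := by
  have hw : ‖Complex.exp ((φ' - φ : ℝ) * Complex.I) * (Real.tanh c : ℂ) ^ 2‖ < 1 := by
    rw [norm_mul, Complex.norm_exp_ofReal_mul_I, one_mul, norm_pow, Complex.norm_real,
      Real.norm_eq_abs, sq_abs]
    exact (sq_lt_one_iff_abs_lt_one _).mpr (Real.abs_tanh_lt_one c)
  have h := (hasSum_centralBinom _ hw).mul_left ((Real.cosh c : ℂ))⁻¹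
  refine ⟨?_, by simpa only [mul_assoc] using h⟩
  have hinj : Function.Injective (fun k : ℕ => 2 * k) := fun a b hab => by
    simpa using hab
  rw [← hinj.hasSum_iff]
  · refine h.congr_fun ?_
    intro k
    exact sqVac_term c φ φ' k
  · intro n hn
    have : ¬ Even n := by
      rintro ⟨m, rfl⟩
      exact hn ⟨m, by simp [two_mul]⟩
    simp [sqVac, this]
end

section
/- Let c be a real number and N ≥ 1 a natural number. Define f : ℝ → ℂ by f(θ) = (1/cosh c) · (1 − e^{iθ} · tanh²(c))^(−1/2) (principal branch of the complex power). Then the multimode squeezing kernel κ(x, x') = Π_{i=1}^N f(x'_i − x_i) on ℝ^N has positive semidefinite Gram matrices: for every M ≥ 1, every choice of points x^1, …, x^M ∈ ℝ^N, and every choice of complex coefficients ζ_1, …, ζ_M, the double sum Σ_{m,m'} conj(ζ_m) · ζ_{m'} · Π_{i=1}^N f(x^{m'}_i − x^m_i) is a nonnegative real number. -/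
theorem squeezing_aux_coeff_nonneg (n : ℕ) : 0 ≤ Ring.multichoose (1 / 2 : ℝ) n := by
  have h := Ring.factorial_nsmul_multichoose_eq_ascPochhammer (1 / 2 : ℝ) n
  rw [Polynomial.ascPochhammer_smeval_eq_eval, nsmul_eq_mul] at h
  have h2 := ascPochhammer_pos n (1 / 2 : ℝ) (by norm_num)
  have h3 : (0 : ℝ) < (n.factorial : ℝ) := by exact_mod_cast n.factorial_pos
  rw [← h] at h2
  exact (pos_of_mul_pos_right h2 h3.le).le

theorem squeezing_aux_hasSum (z : ℂ) (hz : ‖z‖ < 1) :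
    HasSum (fun n : ℕ => ((Ring.multichoose (1 / 2 : ℝ) n : ℝ) : ℂ) * z ^ n)
      ((1 - z) ^ (-(1 / 2 : ℂ))) := by
  have h := (Complex.one_div_one_sub_cpow_hasFPowerSeriesOnBall_zero (1 / 2)).hasSum
    (y := z) (by
      rw [Metric.mem_eball, edist_zero_right, ← ofReal_norm, ENNReal.ofReal_lt_one]
      exact hz)
  simp only [FormalMultilinearSeries.ofScalars_apply_eq, zero_add, smul_eq_mul] at h
  rw [Complex.cpow_neg, ← one_div]
  have e : (fun n : ℕ => ((Ring.multichoose (1 / 2 : ℝ) n : ℝ) : ℂ) * z ^ n) =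
      fun n : ℕ => Ring.choose ((1 / 2 : ℂ) + n - 1) n * z ^ n := by
    funext n
    rw [← Ring.multichoose_eq]
    have := Ring.map_multichoose Complex.ofRealHom (1 / 2 : ℝ) n
    congr 1
    simpa using this
  rw [e]
  exact h

open ComplexOrder in
theorem squeezing_aux_posSemidef (c : ℝ) {M : ℕ} (y : Fin M → ℝ) :
    (Matrix.of fun m m' : Fin M => ((Real.cosh c : ℂ))⁻¹ *
      (1 - Complex.exp (((y m' - y m : ℝ) : ℂ) * Complex.I) * (Real.tanh c : ℂ) ^ 2)
        ^ (-(1 / 2 : ℂ))).PosSemidef := by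
  set A : Matrix (Fin M) (Fin M) ℂ := (Matrix.of fun m m' : Fin M => ((Real.cosh c : ℂ))⁻¹ *
      (1 - Complex.exp (((y m' - y m : ℝ) : ℂ) * Complex.I) * (Real.tanh c : ℂ) ^ 2)
        ^ (-(1 / 2 : ℂ))) with hA
  let u : ℕ → Fin M → ℂ := fun n m => Complex.exp ((y m : ℂ) * Complex.I) ^ n
  let r : ℕ → ℝ := fun n =>
    (Real.cosh c)⁻¹ * (Ring.multichoose (1 / 2 : ℝ) n * (Real.tanh c ^ 2) ^ n)
  let T : ℕ → Matrix (Fin M) (Fin M) ℂ := fun n => (r n : ℂ) • Matrix.vecMulVec (star (u n)) (u n)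
  have hr : ∀ n, 0 ≤ r n := fun n =>
    mul_nonneg (inv_nonneg.2 (Real.cosh_pos c).le)
      (mul_nonneg (squeezing_aux_coeff_nonneg n) (by positivity))
  have hT : ∀ n, (T n).PosSemidef := fun n =>
    (Matrix.posSemidef_vecMulVec_star_self (u n)).smul (by exact_mod_cast hr n)
  have hsum : HasSum T A := by
    refine Pi.hasSum.2 fun m => Pi.hasSum.2 fun m' => ?_
    have hz : ‖Complex.exp (((y m' - y m : ℝ) : ℂ) * Complex.I) * (Real.tanh c : ℂ) ^ 2‖ < 1 := by
      rw [norm_mul, Complex.norm_exp_ofReal_mul_I, one_mul, norm_pow, Complex.norm_real,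
        Real.norm_eq_abs, sq_abs, sq_lt_one_iff_abs_lt_one]
      exact Real.abs_tanh_lt_one c
    have h := (squeezing_aux_hasSum _ hz).mul_left ((Real.cosh c : ℂ))⁻¹
    refine Eq.mp (congrArg (fun g : ℕ → ℂ => HasSum g (A m m')) ?_) h
    funext n
    symm
    have he : Complex.exp (((y m' - y m : ℝ) : ℂ) * Complex.I) =
        (starRingEnd ℂ) (Complex.exp ((y m : ℂ) * Complex.I)) *
          Complex.exp ((y m' : ℂ) * Complex.I) := by
      rw [← Complex.exp_conj, ← Complex.exp_add]
      congr 1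
      simp
      ring
    rw [he]
    simp only [T, r, u, Matrix.smul_apply, Matrix.vecMulVec_apply, Pi.star_apply, smul_eq_mul,
      star_pow, mul_pow, Complex.star_def]
    push_cast
    ring
  have hS : ∀ s : Finset ℕ, (∑ n ∈ s, T n).PosSemidef := fun s =>
    Matrix.posSemidef_sum s fun n _ => hT n
  have hlim : Filter.Tendsto (fun s : Finset ℕ => ∑ n ∈ s, T n) Filter.atTop (nhds A) := hsum
  refine Matrix.PosSemidef.of_dotProduct_mulVec_nonneg ?_ fun v => ?_
  · have h2 : Filter.Tendsto (fun s : Finset ℕ => (∑ n ∈ s, T n).conjTranspose) Filter.atTop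
        (nhds A.conjTranspose) :=
      ((continuous_id.matrix_conjTranspose).tendsto A).comp hlim
    refine tendsto_nhds_unique h2 ?_
    convert hlim using 2 with s
    exact (hS s).1
  · have hc : Continuous fun B : Matrix (Fin M) (Fin M) ℂ => star v ⬝ᵥ (B.mulVec v) := by
      fun_prop
    have h2 := (hc.tendsto A).comp hlim
    exact ge_of_tendsto' h2 fun s => (hS s).dotProduct_mulVec_nonneg v

open ComplexOrder in
theorem squeezing_aux_prod {M : ℕ} {ι : Type*} (s : Finset ι)
    (A : ι → Matrix (Fin M) (Fin M) ℂ) (hA : ∀ i, (A i).PosSemidef) :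
    (Matrix.of fun m m' : Fin M => ∏ i ∈ s, A i m m').PosSemidef := by
  classical
  induction s using Finset.induction_on with
  | empty =>
    have h := Matrix.posSemidef_vecMulVec_star_self (fun _ : Fin M => (1 : ℂ))
    convert h using 1
    ext m m'
    simp [Matrix.vecMulVec_apply]
  | insert a s ha ih =>
    have e : (Matrix.of fun m m' : Fin M => ∏ i ∈ insert a s, A i m m') =
        (A a).hadamard (Matrix.of fun m m' : Fin M => ∏ i ∈ s, A i m m') := by
      ext m m'
      simp [Finset.prod_insert ha]
    rw [e]
    exact (hA a).hadamard ih

/-- The multimode squeezing kernel `κ(x, x') = ∏ i, (1/cosh c)(1 - e^{i(x'_i - x_i)}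
tanh²c)^{-1/2}` (principal branch) has positive semidefinite Gram matrices. -/
theorem multimode_squeezing_kernel_posSemidef (c : ℝ) (N : ℕ) (hN : 1 ≤ N)
    (f : ℝ → ℂ)
    (hf : ∀ θ : ℝ, f θ = ((Real.cosh c : ℂ))⁻¹ *
      (1 - Complex.exp (θ * Complex.I) * (Real.tanh c : ℂ) ^ 2) ^ (-(1 / 2 : ℂ)))
    (M : ℕ) (hM : 1 ≤ M) (x : Fin M → Fin N → ℝ) (ζ : Fin M → ℂ) :
    (∑ m : Fin M, ∑ m' : Fin M,
        (starRingEnd ℂ) (ζ m) * ζ m' * ∏ i : Fin N, f (x m' i - x m i)).im = 0 ∧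
    0 ≤ (∑ m : Fin M, ∑ m' : Fin M,
        (starRingEnd ℂ) (ζ m) * ζ m' * ∏ i : Fin N, f (x m' i - x m i)).re := by
  open ComplexOrder in
  have key := (squeezing_aux_prod Finset.univ _
    (fun i : Fin N => squeezing_aux_posSemidef c (fun m => x m i))).dotProduct_mulVec_nonneg ζ
  have e : (∑ m : Fin M, ∑ m' : Fin M,
        (starRingEnd ℂ) (ζ m) * ζ m' * ∏ i : Fin N, f (x m' i - x m i)) =
      star ζ ⬝ᵥ ((Matrix.of fun m m' : Fin M => ∏ i : Fin N,
        (Matrix.of fun m m' : Fin M => ((Real.cosh c : ℂ))⁻¹ *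
      (1 - Complex.exp (((x m' i - x m i : ℝ) : ℂ) * Complex.I) * (Real.tanh c : ℂ) ^ 2)
        ^ (-(1 / 2 : ℂ))) m m').mulVec ζ) := by
    simp only [dotProduct, Matrix.mulVec, Finset.mul_sum, Matrix.of_apply, hf, Pi.star_apply,
      Complex.star_def]
    refine Finset.sum_congr rfl fun m _ => Finset.sum_congr rfl fun m' _ => ?_
    ring
  rw [e]
  have key2 := Complex.le_def.1 key
  exact ⟨key2.2.symm, key2.1⟩
end
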